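/- For the relativistic oscillator Δ' = μ²/(2s²) − 1/2, s' = MΔ (M > 0, μ ≥ 1 constant) with conserved energy h̄ = (s² + μ²)/(2s) + MΔ²/2 > μ, the motion is periodic and the period in ξ equals ξ_H = 4√(2(h̄+μ)/M) [E(α) − (μ/(h̄+μ)) K(α)], where α = √((h̄−μ)/(h̄+μ)) and K, E are the complete elliptic integrals of the first and second kind. -/

import Mathlib

/-- Complete elliptic integral of the first kind. -/
noncomputable def ellK (α : ℝ) : ℝ :=
  ∫ θ in (0:ℝ)..(Real.pi/2), 1 / Real.sqrt (1 - α^2 * (Real.sin θ)^2)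

/-- Complete elliptic integral of the second kind. -/
noncomputable def ellE (α : ℝ) : ℝ :=
  ∫ θ in (0:ℝ)..(Real.pi/2), Real.sqrt (1 - α^2 * (Real.sin θ)^2)

open Real Set Filter Topology in
/-- The autonomous scalar equation `φ' = 1 / g φ` with `g` positive and periodic has a global
solution through every point, which advances by one period of `g` in time `∫ g`. -/
theorem exists_phase_of_periodic {g : ℝ → ℝ} {T : ℝ} (hg : Continuous g) (hpos : ∀ x, 0 < g x)
    (hT : 0 < T) (hper : Function.Periodic g T) (φ₀ : ℝ) :
    ∃ Φ : ℝ → ℝ, Φ 0 = φ₀ ∧ (∀ ξ, HasDerivAt Φ (g (Φ ξ))⁻¹ ξ) ∧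
      ∀ ξ, Φ (ξ + ∫ x in (0:ℝ)..T, g x) = Φ ξ + T := by
  have hint : ∀ a b, IntervalIntegrable g MeasureTheory.volume a b :=
    fun a b => hg.intervalIntegrable a b
  set G : ℝ → ℝ := fun φ => ∫ x in (0:ℝ)..φ, g x with hG
  have hderiv : ∀ φ, HasDerivAt G (g φ) φ := fun φ =>
    intervalIntegral.integral_hasDerivAt_right (hint _ _)
      (hg.stronglyMeasurableAtFilter _ _) hg.continuousAt
  have hmono : StrictMono G := strictMono_of_deriv_pos fun φ => by
    rw [(hderiv φ).deriv]; exact hpos φ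
  have hcont : Continuous G := continuous_iff_continuousAt.2 fun φ => (hderiv φ).continuousAt
  have hsurj : Function.Surjective G := hcont.surjective
    (hper.tendsto_atTop_intervalIntegral_of_pos' (hint _ _) hpos hT)
    (hper.tendsto_atBot_intervalIntegral_of_pos' (hint _ _) hpos hT)
  let e : ℝ ≃o ℝ := hmono.orderIsoOfSurjective G hsurj
  have he : ∀ φ, e φ = G φ := fun φ => rfl
  have hGe : ∀ y, G (e.symm y) = y := fun y => e.apply_symm_apply y
  have hinv : ∀ y, HasDerivAt e.symm (g (e.symm y))⁻¹ y := fun y =>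
    HasDerivAt.of_local_left_inverse e.symm.continuous.continuousAt (hderiv _) (hpos _).ne'
      (Eventually.of_forall hGe)
  refine ⟨fun ξ => e.symm (ξ + G φ₀), ?_, fun ξ => ?_, fun ξ => ?_⟩
  · simp only [zero_add, ← he, e.symm_apply_apply]
  · exact (hinv (ξ + G φ₀)).comp_add_const ξ (G φ₀)
  · rw [OrderIso.symm_apply_eq, he]
    have h := hper.intervalIntegral_add_eq_add 0 (e.symm (ξ + G φ₀)) hint
    simp only [zero_add] at h
    change _ = ∫ x in (0:ℝ)..(e.symm (ξ + G φ₀) + T), g x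
    rw [h]
    have := hGe (ξ + G φ₀)
    simp only [hG] at this ⊢
    rw [this]
    ring

/-- A continuous even `π`-periodic function has four equal quarter-period integrals. -/
theorem integral_two_pi_eq_four_mul {f : ℝ → ℝ} (hf : Continuous f) (heven : ∀ x, f (-x) = f x)
    (hper : Function.Periodic f Real.pi) :
    ∫ x in (0:ℝ)..(2 * Real.pi), f x = 4 * ∫ x in (0:ℝ)..(Real.pi / 2), f x := by
  have hint : ∀ a b, IntervalIntegrable f MeasureTheory.volume a b :=
    fun a b => hf.intervalIntegrable a b
  have h₁ := hper.intervalIntegral_add_eq_add 0 Real.pi hint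
  have h₂ := hper.intervalIntegral_add_eq 0 (-(Real.pi / 2))
  have h₃ : ∫ x in (-(Real.pi / 2))..0, f x = ∫ x in (0:ℝ)..(Real.pi / 2), f x := by
    have := intervalIntegral.integral_comp_neg f (a := 0) (b := Real.pi / 2)
    simp only [heven, neg_zero] at this
    exact this.symm
  have h₄ := intervalIntegral.integral_add_adjacent_intervals
    (hint (-(Real.pi / 2)) 0) (hint 0 (Real.pi / 2))
  rw [zero_add, show -(Real.pi / 2) + Real.pi = Real.pi / 2 by ring, ← h₄, h₃] at h₂
  rw [zero_add] at h₁
  rw [two_mul, h₁, h₂]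
  ring

/-- Solutions of the oscillator equations with `s` bounded away from zero are determined by their
initial values. -/
theorem oscillator_unique {M μ m : ℝ} (hm : 0 < m) {Δ s Δ' s' : ℝ → ℝ}
    (hsm : ∀ ξ, m ≤ s ξ) (hsm' : ∀ ξ, m ≤ s' ξ)
    (hΔ : ∀ ξ, HasDerivAt Δ (μ^2/(2*(s ξ)^2) - 1/2) ξ)
    (hs : ∀ ξ, HasDerivAt s (M * Δ ξ) ξ)
    (hΔ' : ∀ ξ, HasDerivAt Δ' (μ^2/(2*(s' ξ)^2) - 1/2) ξ)
    (hs' : ∀ ξ, HasDerivAt s' (M * Δ' ξ) ξ)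
    (hΔ₀ : Δ 0 = Δ' 0) (hs₀ : s 0 = s' 0) : Δ = Δ' ∧ s = s' := by
  let v : ℝ → ℝ × ℝ → ℝ × ℝ := fun _ x => (μ^2/(2*x.2^2) - 1/2, M * x.1)
  let S : ℝ → Set (ℝ × ℝ) := fun _ => {x | m ≤ x.2}
  have hlip : ∀ t, LipschitzOnWith (μ^2 / m^3 + |M|).toNNReal (v t) (S t) := by
    intro t
    refine LipschitzOnWith.of_dist_le_mul ?_
    rintro ⟨x₁, a⟩ ha ⟨y₁, b⟩ hb
    change m ≤ a at ha
    change m ≤ b at hb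
    have ha0 : 0 < a := hm.trans_le ha
    have hb0 : 0 < b := hm.trans_le hb
    rw [Real.coe_toNNReal _ (by positivity)]
    simp only [v, Prod.dist_eq, Real.dist_eq]
    have h₁ : |x₁ - y₁| ≤ max |x₁ - y₁| |a - b| := le_max_left _ _
    have h₂ : |a - b| ≤ max |x₁ - y₁| |a - b| := le_max_right _ _
    have hμm : 0 ≤ μ^2 / m^3 := by positivity
    have hinv : 1 / (a * b^2) + 1 / (a^2 * b) ≤ 2 / m^3 := by
      have e₁ : 1 / (a * b^2) ≤ 1 / m^3 := by
        apply one_div_le_one_div_of_le (by positivity)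
        calc m^3 = m * m^2 := by ring
          _ ≤ a * b^2 := by gcongr
      have e₂ : 1 / (a^2 * b) ≤ 1 / m^3 := by
        apply one_div_le_one_div_of_le (by positivity)
        calc m^3 = m^2 * m := by ring
          _ ≤ a^2 * b := by gcongr
      calc _ ≤ 1 / m^3 + 1 / m^3 := add_le_add e₁ e₂
        _ = 2 / m^3 := by ring
    refine max_le ?_ ?_
    · have heq : μ^2/(2*a^2) - 1/2 - (μ^2/(2*b^2) - 1/2)
          = μ^2 / 2 * (1 / (a * b^2) + 1 / (a^2 * b)) * (b - a) := by
        field_simp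
        ring
      rw [heq, abs_mul, abs_of_nonneg (by positivity), abs_sub_comm b a]
      calc _ ≤ μ^2 / 2 * (2 / m^3) * max |x₁ - y₁| |a - b| := by gcongr
        _ = μ^2 / m^3 * max |x₁ - y₁| |a - b| := by ring
        _ ≤ _ := by gcongr; exact le_add_of_nonneg_right (abs_nonneg M)
    · rw [← mul_sub, abs_mul]
      gcongr
      exact le_add_of_nonneg_left hμm
  have h := ODE_solution_unique_univ (v := v) (s := S) (t₀ := 0)
    (f := fun ξ => (Δ ξ, s ξ)) (g := fun ξ => (Δ' ξ, s' ξ)) hlip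
    (fun t => ⟨(hΔ t).prodMk (hs t), hsm t⟩) (fun t => ⟨(hΔ' t).prodMk (hs' t), hsm' t⟩)
    (by simp only [hΔ₀, hs₀])
  exact ⟨funext fun ξ => congrArg Prod.fst (congrFun h ξ),
    funext fun ξ => congrArg Prod.snd (congrFun h ξ)⟩

theorem le_of_oscillator_energy_le {μ h s : ℝ} (hh : 0 < h)
    (hE : s^2 + μ^2 ≤ 2 * s * h) : μ^2 / (2 * h) ≤ s := by
  rw [div_le_iff₀ (by positivity)]
  nlinarith [sq_nonneg s]

/-- The Legendre root `√(1 - m sin² φ)`. -/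
noncomputable def legendreRoot (m φ : ℝ) : ℝ := √(1 - m * Real.sin φ ^ 2)

section legendreRoot

variable {m : ℝ}

theorem one_sub_mul_sin_sq_pos (hm₀ : 0 ≤ m) (hm : m < 1) (φ : ℝ) :
    0 < 1 - m * Real.sin φ ^ 2 := by
  nlinarith [Real.sin_sq_le_one φ]

theorem legendreRoot_pos (hm₀ : 0 ≤ m) (hm : m < 1) (φ : ℝ) : 0 < legendreRoot m φ :=
  Real.sqrt_pos.2 (one_sub_mul_sin_sq_pos hm₀ hm φ)

theorem legendreRoot_sq (hm₀ : 0 ≤ m) (hm : m < 1) (φ : ℝ) :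
    legendreRoot m φ ^ 2 = 1 - m * Real.sin φ ^ 2 :=
  Real.sq_sqrt (one_sub_mul_sin_sq_pos hm₀ hm φ).le

theorem continuous_legendreRoot : Continuous (legendreRoot m) := by
  unfold legendreRoot
  fun_prop

theorem legendreRoot_neg (φ : ℝ) : legendreRoot m (-φ) = legendreRoot m φ := by
  simp [legendreRoot]

theorem legendreRoot_periodic : Function.Periodic (legendreRoot m) Real.pi := fun φ => by
  simp [legendreRoot, Real.sin_add_pi]

theorem hasDerivAt_legendreRoot (hm₀ : 0 ≤ m) (hm : m < 1) (φ : ℝ) :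
    HasDerivAt (legendreRoot m) (-(m * Real.sin φ * Real.cos φ) / legendreRoot m φ) φ := by
  have h := ((((Real.hasDerivAt_sin φ).pow 2).const_mul m).const_sub 1).sqrt
    (one_sub_mul_sin_sq_pos hm₀ hm φ).ne'
  refine h.congr_deriv ?_
  have := (legendreRoot_pos hm₀ hm φ).ne'
  change _ / (2 * legendreRoot m φ) = _
  field_simp
  norm_num
  ring

end legendreRoot

/-- The momentum variable `s` on the orbit of energy `h` as a function of the phase angle `φ`,
where `Δ = D sin φ`. -/
noncomputable def orbitS (M μ h D A φ : ℝ) : ℝ :=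
  μ + (h - μ) * Real.cos φ ^ 2 -
    M * D * A / 2 * Real.cos φ * legendreRoot ((h - μ) / (h + μ)) φ

/-- The derivative `dξ/dφ` of time with respect to the phase angle. -/
noncomputable def orbitTimeDensity (μ h D A φ : ℝ) : ℝ :=
  A * (legendreRoot ((h - μ) / (h + μ)) φ
    - μ / (h + μ) * (1 / legendreRoot ((h - μ) / (h + μ)) φ)) - D * Real.cos φ

section orbit

variable {M μ h D A : ℝ}

theorem modulus_mem (hμ : 0 < μ) (hh : μ < h) :
    0 ≤ (h - μ) / (h + μ) ∧ (h - μ) / (h + μ) < 1 :=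
  ⟨div_nonneg (by linarith) (by linarith), by rw [div_lt_one (by linarith)]; linarith⟩

theorem add_mul_legendreRoot_sq (hμ : 0 < μ) (hh : μ < h) (φ : ℝ) :
    (h + μ) * legendreRoot ((h - μ) / (h + μ)) φ ^ 2 = 2 * μ + (h - μ) * Real.cos φ ^ 2 := by
  have : h + μ ≠ 0 := by linarith
  rw [legendreRoot_sq (modulus_mem hμ hh).1 (modulus_mem hμ hh).2, Real.sin_sq]
  field_simp
  ring

theorem orbit_momentum_sq (hμ : 0 < μ) (hh : μ < h)
    (hD : M * D^2 = 2 * (h - μ)) (hA : M * A^2 = 2 * (h + μ)) (φ : ℝ) :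
    (M * D * A / 2 * Real.cos φ * legendreRoot ((h - μ) / (h + μ)) φ) ^ 2
      = (μ + (h - μ) * Real.cos φ ^ 2) ^ 2 - μ ^ 2 := by
  have hw := add_mul_legendreRoot_sq hμ hh φ
  calc _ = (M * D^2) * (M * A^2) / 4 * Real.cos φ ^ 2 *
        legendreRoot ((h - μ) / (h + μ)) φ ^ 2 := by ring
    _ = (h - μ) * Real.cos φ ^ 2 * ((h + μ) * legendreRoot ((h - μ) / (h + μ)) φ ^ 2) := by
        rw [hD, hA]; ring
    _ = _ := by rw [hw]; ring

theorem orbitS_energy (hμ : 0 < μ) (hh : μ < h)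
    (hD : M * D^2 = 2 * (h - μ)) (hA : M * A^2 = 2 * (h + μ)) (φ : ℝ) :
    orbitS M μ h D A φ ^ 2 + μ ^ 2
      = 2 * orbitS M μ h D A φ * (μ + (h - μ) * Real.cos φ ^ 2) := by
  have := orbit_momentum_sq hμ hh hD hA φ
  unfold orbitS
  linear_combination this

theorem orbitS_pos (hμ : 0 < μ) (hh : μ < h)
    (hD : M * D^2 = 2 * (h - μ)) (hA : M * A^2 = 2 * (h + μ)) (φ : ℝ) :
    0 < orbitS M μ h D A φ := by
  have h₁ := orbitS_energy hμ hh hD hA φ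
  have h₂ : 0 < μ + (h - μ) * Real.cos φ ^ 2 := by
    have : 0 < h - μ := by linarith
    positivity
  by_contra! hneg
  nlinarith [sq_nonneg (orbitS M μ h D A φ), mul_nonneg (neg_nonneg.2 hneg) h₂.le,
    mul_pos hμ hμ]

theorem orbitTimeDensity_mul (hμ : 0 < μ) (hh : μ < h) (hA : M * A^2 = 2 * (h + μ)) (φ : ℝ) :
    orbitTimeDensity μ h D A φ * (M * A / 2 * legendreRoot ((h - μ) / (h + μ)) φ)
      = orbitS M μ h D A φ := by
  have hw := add_mul_legendreRoot_sq hμ hh φ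
  have hpos := legendreRoot_pos (modulus_mem hμ hh).1 (modulus_mem hμ hh).2 φ
  have hne : h + μ ≠ 0 := by linarith
  unfold orbitTimeDensity orbitS
  generalize legendreRoot ((h - μ) / (h + μ)) φ = w at *
  have : A * (w - μ / (h + μ) * (1 / w)) * (M * A / 2 * w)
      = M * A ^ 2 / 2 * (w ^ 2 - μ / (h + μ)) := by
    field_simp
  rw [sub_mul, this, hA]
  have : 2 * (h + μ) / 2 * (w ^ 2 - μ / (h + μ)) = (h + μ) * w ^ 2 - μ := by
    field_simp
  rw [this, hw]
  ring

theorem orbitTimeDensity_pos (hM : 0 < M) (hμ : 0 < μ) (hh : μ < h) (hA₀ : 0 < A)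
    (hD : M * D^2 = 2 * (h - μ)) (hA : M * A^2 = 2 * (h + μ)) (φ : ℝ) :
    0 < orbitTimeDensity μ h D A φ := by
  have hpos := legendreRoot_pos (modulus_mem hμ hh).1 (modulus_mem hμ hh).2 φ
  have h₁ := orbitS_pos hμ hh hD hA φ
  rw [← orbitTimeDensity_mul hμ hh hA φ] at h₁
  exact pos_of_mul_pos_left h₁ (by positivity)

theorem continuous_orbitTimeDensity (hμ : 0 < μ) (hh : μ < h) :
    Continuous (orbitTimeDensity μ h D A) := by
  have hw : ∀ φ, legendreRoot ((h - μ) / (h + μ)) φ ≠ 0 := fun φ =>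
    (legendreRoot_pos (modulus_mem hμ hh).1 (modulus_mem hμ hh).2 φ).ne'
  have hc : Continuous (legendreRoot ((h - μ) / (h + μ))) := continuous_legendreRoot
  unfold orbitTimeDensity
  fun_prop (disch := assumption)

theorem orbitTimeDensity_periodic :
    Function.Periodic (orbitTimeDensity μ h D A) (2 * Real.pi) := fun φ => by
  have : legendreRoot ((h - μ) / (h + μ)) (φ + 2 * Real.pi)
      = legendreRoot ((h - μ) / (h + μ)) φ := by
    simpa using legendreRoot_periodic.nat_mul 2 φ
  simp only [orbitTimeDensity, this, Real.cos_add_two_pi]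

theorem orbitS_periodic : Function.Periodic (orbitS M μ h D A) (2 * Real.pi) := fun φ => by
  have : legendreRoot ((h - μ) / (h + μ)) (φ + 2 * Real.pi)
      = legendreRoot ((h - μ) / (h + μ)) φ := by
    simpa using legendreRoot_periodic.nat_mul 2 φ
  simp only [orbitS, this, Real.cos_add_two_pi]

theorem integral_orbitTimeDensity (hμ : 0 < μ) (hh : μ < h) :
    ∫ φ in (0:ℝ)..(2 * Real.pi), orbitTimeDensity μ h D A φ
      = 4 * A * (ellE √((h - μ) / (h + μ)) - μ / (h + μ) * ellK √((h - μ) / (h + μ))) := by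
  obtain ⟨hm₀, hm⟩ := modulus_mem hμ hh
  set m := (h - μ) / (h + μ) with hmdef
  have hw : ∀ φ, legendreRoot m φ ≠ 0 := fun φ => (legendreRoot_pos hm₀ hm φ).ne'
  have hc : Continuous (legendreRoot m) := continuous_legendreRoot
  have hci : Continuous fun φ => 1 / legendreRoot m φ := by
    fun_prop (disch := assumption)
  have hE : ellE √m = ∫ φ in (0:ℝ)..(Real.pi / 2), legendreRoot m φ := by
    simp only [ellE, legendreRoot, Real.sq_sqrt hm₀]
  have hK : ellK √m = ∫ φ in (0:ℝ)..(Real.pi / 2), 1 / legendreRoot m φ := by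
    simp only [ellK, legendreRoot, Real.sq_sqrt hm₀]
  have hf : Continuous fun φ => legendreRoot m φ - μ / (h + μ) * (1 / legendreRoot m φ) := by
    fun_prop
  have hquarter := integral_two_pi_eq_four_mul hf (fun φ => by simp only [legendreRoot_neg])
    (fun φ => by simp only [legendreRoot_periodic φ])
  simp only [orbitTimeDensity, ← hmdef]
  rw [intervalIntegral.integral_sub ((hf.const_mul A).intervalIntegrable _ _)
      ((Real.continuous_cos.const_mul D).intervalIntegrable _ _),
    intervalIntegral.integral_const_mul, intervalIntegral.integral_const_mul, hquarter,
    integral_cos, Real.sin_two_pi, Real.sin_zero, intervalIntegral.integral_sub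
      (hc.intervalIntegrable _ _) ((hci.const_mul _).intervalIntegrable _ _),
    intervalIntegral.integral_const_mul, hE, hK]
  ring

theorem hasDerivAt_orbitS (hμ : 0 < μ) (hh : μ < h)
    (hD : M * D^2 = 2 * (h - μ)) (φ : ℝ) :
    HasDerivAt (orbitS M μ h D A)
      (M * (D * Real.sin φ) * orbitTimeDensity μ h D A φ) φ := by
  obtain ⟨hm₀, hm⟩ := modulus_mem hμ hh
  have h₁ := ((((Real.hasDerivAt_cos φ).pow 2).const_mul (h - μ)).const_add μ).sub
    (((Real.hasDerivAt_cos φ).const_mul (M * D * A / 2)).mul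
      (hasDerivAt_legendreRoot hm₀ hm φ))
  refine h₁.congr_deriv ?_
  have hw := add_mul_legendreRoot_sq hμ hh φ
  have hpos := legendreRoot_pos hm₀ hm φ
  have hne : h + μ ≠ 0 := by linarith
  unfold orbitTimeDensity
  generalize legendreRoot ((h - μ) / (h + μ)) φ = w at *
  norm_num
  field_simp
  linear_combination (2 * w * (h + μ) * Real.cos φ * Real.sin φ) * hD
    - M * D * A * Real.sin φ * hw

/-- Every phase point of energy `h` lies on the parametrized orbit. -/
theorem exists_orbit_phase (hM : 0 < M) (hμ : 0 < μ) (hh : μ < h) (hD₀ : 0 < D) (hA₀ : 0 < A)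
    (hD : M * D^2 = 2 * (h - μ)) (hA : M * A^2 = 2 * (h + μ)) {Δ₀ s₀ : ℝ} (hs₀ : 0 < s₀)
    (hE : (s₀^2 + μ^2) / (2 * s₀) + M * Δ₀^2 / 2 = h) :
    ∃ φ, D * Real.sin φ = Δ₀ ∧ orbitS M μ h D A φ = s₀ := by
  have hγ : μ ≤ (s₀^2 + μ^2) / (2 * s₀) := by
    rw [le_div_iff₀ (by positivity)]
    nlinarith [sq_nonneg (s₀ - μ)]
  have hsq : Δ₀ ^ 2 ≤ D ^ 2 := by
    have : M * Δ₀ ^ 2 ≤ M * D ^ 2 := by linarith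
    exact le_of_mul_le_mul_left this hM
  have habs := abs_le.1 (abs_le_of_sq_le_sq hsq hD₀.le)
  have hlow : -1 ≤ Δ₀ / D := by rw [le_div_iff₀ hD₀]; linarith
  have hupp : Δ₀ / D ≤ 1 := by rw [div_le_one hD₀]; linarith
  have key : ∀ φ, D * Real.sin φ = Δ₀ → 0 ≤ Real.cos φ * (μ - s₀) →
      orbitS M μ h D A φ = s₀ := by
    intro φ hsin hsign
    have hcos : μ + (h - μ) * Real.cos φ ^ 2 = (s₀^2 + μ^2) / (2 * s₀) := by
      rw [Real.cos_sq']
      rw [← hsin] at hE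
      linear_combination (Real.sin φ ^ 2 / 2) * hD - hE
    have hp := orbit_momentum_sq hμ hh hD hA φ
    have hwpos := legendreRoot_pos (modulus_mem hμ hh).1 (modulus_mem hμ hh).2 φ
    have hq : (M * D * A / 2 * Real.cos φ * legendreRoot ((h - μ) / (h + μ)) φ) ^ 2
        = ((μ^2 - s₀^2) / (2 * s₀)) ^ 2 := by
      rw [hp, hcos]
      field_simp
      ring
    have hprod : 0 ≤ (M * D * A / 2 * Real.cos φ * legendreRoot ((h - μ) / (h + μ)) φ)
        * ((μ^2 - s₀^2) / (2 * s₀)) := by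
      have : (M * D * A / 2 * Real.cos φ * legendreRoot ((h - μ) / (h + μ)) φ)
          * ((μ^2 - s₀^2) / (2 * s₀))
          = (Real.cos φ * (μ - s₀)) * (M * D * A / 2 * legendreRoot ((h - μ) / (h + μ)) φ
            * ((μ + s₀) / (2 * s₀))) := by ring
      rw [this]
      positivity
    have hmom : M * D * A / 2 * Real.cos φ * legendreRoot ((h - μ) / (h + μ)) φ
        = (μ^2 - s₀^2) / (2 * s₀) := by
      rcases sq_eq_sq_iff_eq_or_eq_neg.1 hq with h₁ | h₁
      · exact h₁
      · rw [h₁] at hprod ⊢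
        have : (μ^2 - s₀^2) / (2 * s₀) = 0 := by
          by_contra hne
          nlinarith [pow_pos (abs_pos.2 hne) 2, sq_abs ((μ^2 - s₀^2) / (2 * s₀))]
        rw [this, neg_zero]
    rw [orbitS, hmom, hcos]
    field_simp
    ring
  have hsin : D * Real.sin (Real.arcsin (Δ₀ / D)) = Δ₀ := by
    rw [Real.sin_arcsin hlow hupp]
    field_simp
  rcases le_total s₀ μ with hle | hle
  · exact ⟨_, hsin, key _ hsin
      (mul_nonneg (Real.cos_arcsin_nonneg _) (by linarith))⟩
  · have hsin' : D * Real.sin (Real.pi - Real.arcsin (Δ₀ / D)) = Δ₀ := by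
      rwa [Real.sin_pi_sub]
    refine ⟨_, hsin', key _ hsin' ?_⟩
    rw [Real.cos_pi_sub]
    exact mul_nonneg_of_nonpos_of_nonpos
      (neg_nonpos.2 (Real.cos_arcsin_nonneg _)) (by linarith)

end orbit

/-- For the relativistic harmonic oscillator with conserved energy `h̄ > μ`, the motion
is periodic with period `ξ_H = 4√(2(h̄+μ)/M)[E(α) - (μ/(h̄+μ))K(α)]`,
`α = √((h̄-μ)/(h̄+μ))`. -/
theorem relativistic_oscillator_period
    (M μ h : ℝ) (hM : 0 < M) (hμ : 1 ≤ μ) (hh : μ < h)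
    (Δ s : ℝ → ℝ) (hspos : ∀ ξ, 0 < s ξ)
    (hΔ : ∀ ξ, HasDerivAt Δ (μ^2/(2*(s ξ)^2) - 1/2) ξ)
    (hs : ∀ ξ, HasDerivAt s (M * Δ ξ) ξ)
    (hE : ∀ ξ, ((s ξ)^2 + μ^2)/(2*s ξ) + M * (Δ ξ)^2 / 2 = h) :
    Function.Periodic Δ
      (4 * Real.sqrt (2*(h+μ)/M) *
        (ellE (Real.sqrt ((h-μ)/(h+μ))) - μ/(h+μ) * ellK (Real.sqrt ((h-μ)/(h+μ))))) ∧
    Function.Periodic s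
      (4 * Real.sqrt (2*(h+μ)/M) *
        (ellE (Real.sqrt ((h-μ)/(h+μ))) - μ/(h+μ) * ellK (Real.sqrt ((h-μ)/(h+μ))))) := by
  have hμ₀ : 0 < μ := by linarith
  have hh₀ : 0 < h := by linarith
  set A := Real.sqrt (2*(h+μ)/M) with hAdef
  set D := Real.sqrt (2*(h-μ)/M) with hDdef
  have hA₀ : 0 < A := Real.sqrt_pos.2 (div_pos (by linarith) hM)
  have hD₀ : 0 < D := Real.sqrt_pos.2 (div_pos (by linarith) hM)
  have hA : M * A^2 = 2 * (h + μ) := by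
    rw [hAdef, Real.sq_sqrt (div_nonneg (by linarith) hM.le)]
    field_simp
  have hD : M * D^2 = 2 * (h - μ) := by
    rw [hDdef, Real.sq_sqrt (div_nonneg (by linarith) hM.le)]
    field_simp
  obtain ⟨φ₀, hφΔ, hφs⟩ := exists_orbit_phase hM hμ₀ hh hD₀ hA₀ hD hA (hspos 0) (hE 0)
  have hgpos := orbitTimeDensity_pos hM hμ₀ hh hA₀ hD hA
  obtain ⟨Φ, hΦ₀, hΦ, hΦper⟩ := exists_phase_of_periodic (continuous_orbitTimeDensity hμ₀ hh)
    hgpos Real.two_pi_pos orbitTimeDensity_periodic φ₀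
  rw [integral_orbitTimeDensity hμ₀ hh] at hΦper
  have hΔ' : ∀ ξ, HasDerivAt (fun ξ => D * Real.sin (Φ ξ))
      (μ^2/(2*(orbitS M μ h D A (Φ ξ))^2) - 1/2) ξ := by
    intro ξ
    refine ((hΦ ξ).sin.const_mul D).congr_deriv ?_
    have h₁ := orbitTimeDensity_mul (D := D) hμ₀ hh hA (Φ ξ)
    have h₂ := orbitS_energy hμ₀ hh hD hA (Φ ξ)
    have h₃ := orbitS_pos hμ₀ hh hD hA (Φ ξ)
    have h₄ := (hgpos (Φ ξ)).ne'
    have h₅ : orbitS M μ h D A (Φ ξ) = μ + (h - μ) * Real.cos (Φ ξ) ^ 2 -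
      M * D * A / 2 * Real.cos (Φ ξ) * legendreRoot ((h - μ) / (h + μ)) (Φ ξ) := rfl
    generalize orbitS M μ h D A (Φ ξ) = σ at *
    generalize orbitTimeDensity μ h D A (Φ ξ) = g at *
    generalize legendreRoot ((h - μ) / (h + μ)) (Φ ξ) = w at *
    have h₆ : μ ^ 2 - σ ^ 2 = 2 * σ * (D * Real.cos (Φ ξ) * (M * A / 2 * w)) := by
      linear_combination h₂ - 2 * σ * h₅
    have h₇ : g * (μ ^ 2 - σ ^ 2) = 2 * σ ^ 2 * (D * Real.cos (Φ ξ)) := by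
      rw [h₆]
      linear_combination (2 * σ * D * Real.cos (Φ ξ)) * h₁
    field_simp
    linear_combination -h₇
  have hs' : ∀ ξ, HasDerivAt (fun ξ => orbitS M μ h D A (Φ ξ))
      (M * (D * Real.sin (Φ ξ))) ξ := by
    intro ξ
    refine ((hasDerivAt_orbitS hμ₀ hh hD (Φ ξ)).comp ξ (hΦ ξ)).congr_deriv ?_
    rw [mul_assoc, mul_inv_cancel₀ (hgpos (Φ ξ)).ne', mul_one]
  have hsm : ∀ ξ, μ^2 / (2 * h) ≤ s ξ := fun ξ => by
    refine le_of_oscillator_energy_le hh₀ ?_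
    have hpos := hspos ξ
    have h₁ : ((s ξ)^2 + μ^2) / (2 * s ξ) ≤ h := by
      rw [← hE ξ]
      exact le_add_of_nonneg_right (by positivity)
    rw [div_le_iff₀ (by positivity)] at h₁
    linarith
  have hsm' : ∀ ξ, μ^2 / (2 * h) ≤ orbitS M μ h D A (Φ ξ) := fun ξ => by
    have hpos := orbitS_pos hμ₀ hh hD hA (Φ ξ)
    refine le_of_oscillator_energy_le hh₀ ?_
    rw [orbitS_energy hμ₀ hh hD hA (Φ ξ)]
    gcongr
    nlinarith [Real.cos_sq_le_one (Φ ξ)]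
  obtain ⟨rfl, rfl⟩ := oscillator_unique (by positivity) hsm hsm' hΔ hs hΔ' hs'
    (by rw [hΦ₀, hφΔ]) (by rw [hΦ₀, hφs])
  exact ⟨fun ξ => by simp only [hΦper, Real.sin_add_two_pi],
    fun ξ => by simp only [hΦper, orbitS_periodic (Φ ξ)]⟩
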